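/- Let ρ and ρ' be density matrices of the same finite dimension with S(ρ) < S(ρ') and rank(ρ) ≤ rank(ρ'). Then there exists a finite-dimensional density matrix τ and a bipartite density matrix γ on the tensor product of the two spaces such that ρ ⊗ τ majorizes γ, tr₂[γ] = ρ', and tr₁[γ] = τ. -/

import Mathlib

open scoped Kronecker ComplexOrder
open Matrix

noncomputable section

/-- `ρ` is a density matrix: positive semidefinite with unit trace. -/
def IsDensityMatrix {ι : Type*} [Fintype ι] (ρ : Matrix ι ι ℂ) : Prop :=
  ρ.PosSemidef ∧ ρ.trace = 1

/-- Partial trace over the second tensor factor. -/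
def ptrace2 {ι κ : Type*} [Fintype κ] (M : Matrix (ι × κ) (ι × κ) ℂ) : Matrix ι ι ℂ :=
  Matrix.of fun i j => ∑ k, M (i, k) (j, k)

/-- Partial trace over the first tensor factor. -/
def ptrace1 {ι κ : Type*} [Fintype ι] (M : Matrix (ι × κ) (ι × κ) ℂ) : Matrix κ κ ℂ :=
  Matrix.of fun i j => ∑ k, M (k, i) (k, j)

/-- Dephasing (decoherence) channel in the fixed (standard) orthonormal basis `{|j⟩}`:
`D[σ] = ∑ j ⟨j|σ|j⟩ |j⟩⟨j|`. -/
def deph {ι : Type*} [DecidableEq ι] (M : Matrix ι ι ℂ) : Matrix ι ι ℂ :=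
  Matrix.diagonal fun j => M j j

/-- The eigenvalue list of a matrix (junk value `0` if not Hermitian). -/
def eigs {ι : Type*} [Fintype ι] [DecidableEq ι] (ρ : Matrix ι ι ℂ) : ι → ℝ :=
  if h : ρ.IsHermitian then h.eigenvalues else 0

/-- The spectrum of a matrix, as a multiset of real eigenvalues (with multiplicity). -/
def spectra {ι : Type*} [Fintype ι] [DecidableEq ι] (ρ : Matrix ι ι ℂ) : Multiset ℝ :=
  Finset.univ.val.map (eigs ρ)

/-- von Neumann entropy `S(ρ) = -tr(ρ log ρ)`, i.e. the Shannon entropy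
of the eigenvalue list (natural logarithm). -/
def vN {ι : Type*} [Fintype ι] [DecidableEq ι] (ρ : Matrix ι ι ℂ) : ℝ :=
  ∑ i, Real.negMulLog (eigs ρ i)

/-- Maximally mixed state `𝟙_d = (1/d)·I_d`. -/
def mm (d : ℕ) : Matrix (Fin d) (Fin d) ℂ :=
  (d : ℂ)⁻¹ • (1 : Matrix (Fin d) (Fin d) ℂ)

/-- The sum of the `k` largest entries of `a`, expressed as the supremum of sums over
subsets of cardinality `k`. -/
def kSum {ι : Type*} [Fintype ι] (a : ι → ℝ) (k : ℕ) : ℝ :=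
  ⨆ s ∈ {s : Finset ι | s.card = k}, ∑ i ∈ s, a i

/-- `a` majorizes `b`: for every `k`, the sum of the `k` largest entries of `a` is at least
that of `b`, with equality of the total sums. -/
def Maj {ι : Type*} [Fintype ι] (a b : ι → ℝ) : Prop :=
  (∀ k : ℕ, kSum b k ≤ kSum a k) ∧ ∑ i, a i = ∑ i, b i


/-! ### Concentration for independent samples -/

/-- The `n`-fold product weight of `p`. -/
def iid {α : Type*} (p : α → ℝ) (n : ℕ) (x : Fin n → α) : ℝ := ∏ i, p (x i)

theorem sum_fin_succ_fun {α : Type*} [Fintype α] {n : ℕ} (j : Fin (n + 1))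
    (F : (Fin (n + 1) → α) → ℝ) :
    ∑ x, F x = ∑ a, ∑ y : Fin n → α, F (j.insertNth (α := fun _ => α) a y) := by
  rw [← Fintype.sum_prod_type']
  exact (Fintype.sum_equiv (Fin.insertNthEquiv (fun _ => α) j) _ _ (fun _ => rfl)).symm

theorem iid_nonneg {α : Type*} {p : α → ℝ} (hp : ∀ a, 0 ≤ p a) (n : ℕ) (x : Fin n → α) :
    0 ≤ iid p n x := Finset.prod_nonneg fun _ _ => hp _

theorem iid_sum {α : Type*} [Fintype α] {p : α → ℝ} (h1 : ∑ a, p a = 1) (n : ℕ) :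
    ∑ x, iid p n x = 1 := by
  classical
  have := Finset.prod_univ_sum (fun _ : Fin n => (Finset.univ : Finset α)) (fun _ a => p a)
  simp only [h1, Finset.prod_const_one, Fintype.piFinset_univ] at this
  exact this.symm

theorem iid_variance {α : Type*} [Fintype α] {p g : α → ℝ} (h1 : ∑ a, p a = 1)
    (h0 : ∑ a, p a * g a = 0) (n : ℕ) :
    ∑ x, iid p n x * (∑ i, g (x i)) = 0 ∧
    ∑ x, iid p n x * (∑ i, g (x i)) ^ 2 = n * ∑ a, p a * g a ^ 2 := by
  induction n with
  | zero => simp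
  | succ n ih =>
    obtain ⟨ih1, ih2⟩ := ih
    have hs := iid_sum h1 n
    constructor
    · rw [sum_fin_succ_fun 0]
      have : ∀ a, ∑ y : Fin n → α, iid p (n + 1) (Fin.insertNth (α := fun _ => α) 0 a y) *
          (∑ i, g (Fin.insertNth (α := fun _ => α) 0 a y i)) = p a * g a := by
        intro a
        have : ∀ y : Fin n → α, iid p (n + 1) (Fin.insertNth (α := fun _ => α) 0 a y) *
          (∑ i, g (Fin.insertNth (α := fun _ => α) 0 a y i)) =
          (p a * g a) * iid p n y + p a * (iid p n y * ∑ i, g (y i)) := by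
          intro y
          simp only [iid, Fin.prod_univ_succ, Fin.sum_univ_succ, Fin.insertNth_zero', Fin.cons_zero,
            Fin.cons_succ]
          ring
        simp only [this, Finset.sum_add_distrib, ← Finset.mul_sum, hs, ih1]
        ring
      simp only [this, h0]
    · rw [sum_fin_succ_fun 0]
      have : ∀ a, ∑ y : Fin n → α, iid p (n + 1) (Fin.insertNth (α := fun _ => α) 0 a y) *
          (∑ i, g (Fin.insertNth (α := fun _ => α) 0 a y i)) ^ 2 =
          p a * g a ^ 2 + p a * (n * ∑ a, p a * g a ^ 2) := by
        intro a
        have : ∀ y : Fin n → α, iid p (n + 1) (Fin.insertNth (α := fun _ => α) 0 a y) *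
          (∑ i, g (Fin.insertNth (α := fun _ => α) 0 a y i)) ^ 2 =
          (p a * g a ^ 2) * iid p n y + (2 * p a * g a) * (iid p n y * ∑ i, g (y i)) +
            p a * (iid p n y * (∑ i, g (y i)) ^ 2) := by
          intro y
          simp only [iid, Fin.prod_univ_succ, Fin.sum_univ_succ, Fin.insertNth_zero', Fin.cons_zero,
            Fin.cons_succ]
          ring
        simp only [this, Finset.sum_add_distrib, ← Finset.mul_sum, hs, ih1, ih2]
        ring
      simp only [this, Finset.sum_add_distrib, ← Finset.sum_mul, h1]
      push_cast
      ring

open Filter in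
/-- The weak law of large numbers on a finite alphabet. -/
theorem eventually_deviation_le {α : Type*} [Fintype α] {p : α → ℝ} (hp : ∀ a, 0 ≤ p a)
    (h1 : ∑ a, p a = 1) (f : α → ℝ) {δ ε : ℝ} (hδ : 0 < δ) (hε : 0 < ε) :
    ∀ᶠ n : ℕ in atTop,
      ∑ x with n * δ < |∑ i, f (x i) - n * ∑ a, p a * f a|, iid p n x ≤ ε := by
  set μ := ∑ a, p a * f a with hμ
  set V := ∑ a, p a * (f a - μ) ^ 2 with hV
  have h0 : ∑ a, p a * (f a - μ) = 0 := by
    simp only [mul_sub, Finset.sum_sub_distrib, ← Finset.sum_mul, h1, ← hμ]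
    ring
  obtain ⟨N, hN⟩ := exists_nat_gt (V / (δ ^ 2 * ε))
  filter_upwards [eventually_ge_atTop (N + 1)] with n hn
  have hn0 : (0 : ℝ) < n := by exact_mod_cast (by omega : 0 < n)
  have hnN : V / (δ ^ 2 * ε) < n := hN.trans (by exact_mod_cast (by omega : N < n))
  rw [div_lt_iff₀ (by positivity)] at hnN
  have hvar := (iid_variance h1 h0 n).2
  have key : (n * δ) ^ 2 * ∑ x with n * δ < |∑ i, f (x i) - n * μ|, iid p n x ≤ n * V := by
    rw [← hvar, Finset.mul_sum]
    refine (Finset.sum_le_sum (fun x hx => ?_)).trans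
      (Finset.sum_le_sum_of_subset_of_nonneg (Finset.filter_subset _ _)
        (fun x _ _ => mul_nonneg (iid_nonneg hp n x) (sq_nonneg _)))
    rw [Finset.mem_filter] at hx
    rw [mul_comm]
    refine mul_le_mul_of_nonneg_left ?_ (iid_nonneg hp n x)
    rw [Finset.sum_sub_distrib, Finset.sum_const, Finset.card_univ, Fintype.card_fin, nsmul_eq_mul,
      ← sq_abs (∑ i, f (x i) - n * μ)]
    exact pow_le_pow_left₀ (by positivity) hx.2.le 2
  set m := ∑ x with n * δ < |∑ i, f (x i) - n * μ|, iid p n x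
  by_contra hm
  push Not at hm
  have : n * V < (n * δ) ^ 2 * m := by
    calc n * V < n * (n * (δ ^ 2 * ε)) := by gcongr
      _ = (n * δ) ^ 2 * ε := by ring
      _ ≤ (n * δ) ^ 2 * m := by gcongr
  linarith

/-! ### Typical sets -/

theorem exists_perm_mapsTo {X : Type*} [Fintype X] [DecidableEq X] {A B : Finset X}
    (h : B.card ≤ A.card) : ∃ e : Equiv.Perm X, ∀ y ∈ B, e y ∈ A := by
  obtain ⟨A', hA', hc⟩ := Finset.exists_subset_card_eq h
  let f : B ≃ A' := Finset.equivOfCardEq hc.symm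
  refine ⟨f.extendSubtype, fun y hy => hA' ?_⟩
  rw [Equiv.extendSubtype_apply_of_mem f y hy]
  exact (f ⟨y, hy⟩).2

theorem iid_eq_exp {α : Type*} {p : α → ℝ} {n : ℕ} {x : Fin n → α} (h : ∀ i, 0 < p (x i)) :
    iid p n x = Real.exp (-∑ i, -Real.log (p (x i))) := by
  rw [Finset.sum_neg_distrib, neg_neg, Real.exp_sum]
  exact Finset.prod_congr rfl fun i _ => (Real.exp_log (h i)).symm

theorem sum_mul_neg_log {α : Type*} [Fintype α] (p : α → ℝ) :
    ∑ a, p a * -Real.log (p a) = ∑ a, Real.negMulLog (p a) :=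
  Finset.sum_congr rfl fun a _ => by rw [Real.negMulLog]; ring

/-- Number of occurrences of the letter `a` in the word `x`. -/
def letterCount {α : Type*} [DecidableEq α] {n : ℕ} (x : Fin n → α) (a : α) : ℝ :=
  ∑ i, if x i = a then 1 else 0

theorem letterCount_nonneg {α : Type*} [DecidableEq α] {n : ℕ} (x : Fin n → α) (a : α) :
    0 ≤ letterCount x a := Finset.sum_nonneg fun _ _ => by split_ifs <;> norm_num

theorem letterCount_le {α : Type*} [DecidableEq α] {n : ℕ} (x : Fin n → α) (a : α) :
    letterCount x a ≤ n := by
  calc letterCount x a ≤ ∑ _i : Fin n, (1 : ℝ) :=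
        Finset.sum_le_sum fun _ _ => by split_ifs <;> norm_num
    _ = n := by simp

theorem letterCount_sum {α : Type*} [Fintype α] [DecidableEq α] {n : ℕ} (x : Fin n → α) :
    ∑ a, letterCount x a = n := by
  simp only [letterCount]
  rw [Finset.sum_comm]
  simp

open Filter in
/-- If `t` has full support, the words of length `n` that are letter-typical for `t`
eventually outnumber `exp (n r)`, for every rate `r` below the entropy of `t`. -/
theorem eventually_card_typical_ge {α : Type*} [Fintype α] [DecidableEq α] {t : α → ℝ}
    (ht : ∀ a, 0 < t a) (ht1 : ∑ a, t a = 1) {η r : ℝ} (hη : 0 < η)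
    (hr : r < ∑ a, Real.negMulLog (t a)) :
    ∀ᶠ n : ℕ in atTop, Real.exp (n * r) ≤
      (Finset.univ.filter fun x : Fin n → α =>
        ∀ a, |letterCount x a - n * t a| ≤ n * η).card := by
  set H := ∑ a, Real.negMulLog (t a) with hH
  set c : ℝ := 1 / (4 * (Fintype.card α + 1)) with hc
  have hc0 : 0 < c := by positivity
  have hδ : 0 < (H - r) / 2 := by linarith
  have e1 : ∀ᶠ n : ℕ in atTop, ∀ a,
      ∑ x with n * η < |letterCount x a - n * t a|, iid t n x ≤ c := by
    rw [eventually_all]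
    intro a
    have := eventually_deviation_le (fun a => (ht a).le) ht1 (fun b => if b = a then 1 else 0)
      hη hc0
    simpa [letterCount] using this
  have e2 := eventually_deviation_le (fun a => (ht a).le) ht1 (fun b => -Real.log (t b)) hδ
    (show (0 : ℝ) < 1 / 4 by norm_num)
  obtain ⟨N, hN⟩ := exists_nat_gt (Real.log 2 / ((H - r) / 2))
  filter_upwards [e1, e2, eventually_ge_atTop N] with n h1 h2 hn
  have hnN : Real.log 2 < n * ((H - r) / 2) := by
    rw [← div_lt_iff₀ hδ]
    exact hN.trans_le (by exact_mod_cast hn)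
  rw [sum_mul_neg_log, ← hH] at h2
  set A := Finset.univ.filter fun x : Fin n → α => ∀ a, |letterCount x a - n * t a| ≤ n * η
  set A' := A.filter fun x => |∑ i, -Real.log (t (x i)) - n * H| ≤ n * ((H - r) / 2) with hA'
  have hmass : (1 : ℝ) / 2 ≤ ∑ x ∈ A', iid t n x := by
    have hnn := iid_nonneg (fun a => (ht a).le) n
    have hpt : ∀ x : Fin n → α, iid t n x ≤ (if x ∈ A' then iid t n x else 0) +
        (if n * ((H - r) / 2) < |∑ i, -Real.log (t (x i)) - n * H| then iid t n x else 0) +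
        ∑ a, (if n * η < |letterCount x a - n * t a| then iid t n x else 0) := by
      intro x
      have hs : ∀ b, 0 ≤ if n * η < |letterCount x b - n * t b| then iid t n x else 0 :=
        fun b => by split_ifs <;> simp [hnn x]
      have hs' := Finset.sum_nonneg fun b (_ : b ∈ Finset.univ) => hs b
      by_cases hx : x ∈ A'
      · rw [if_pos hx]
        have : 0 ≤ if n * ((H - r) / 2) < |∑ i, -Real.log (t (x i)) - n * H|
          then iid t n x else 0 := by split_ifs <;> simp [hnn x]
        linarith
      · by_cases hx2 : n * ((H - r) / 2) < |∑ i, -Real.log (t (x i)) - n * H|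
        · rw [if_neg hx, if_pos hx2]
          linarith
        · have : x ∉ A := fun h => hx (Finset.mem_filter.2 ⟨h, not_lt.1 hx2⟩)
          simp only [A, Finset.mem_filter, Finset.mem_univ, true_and, not_forall, not_le] at this
          obtain ⟨a, ha⟩ := this
          have := Finset.single_le_sum (fun b (_ : b ∈ Finset.univ) => hs b) (Finset.mem_univ a)
          rw [if_pos ha] at this
          rw [if_neg hx, if_neg hx2]
          linarith
    have := Finset.sum_le_sum fun x (_ : x ∈ Finset.univ) => hpt x
    rw [iid_sum ht1, Finset.sum_add_distrib, Finset.sum_add_distrib, Finset.sum_comm,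
      ← Finset.sum_filter, ← Finset.sum_filter, Finset.filter_mem_eq_inter,
      Finset.univ_inter] at this
    simp only [← Finset.sum_filter] at this
    have h3 := Finset.sum_le_sum fun a (_ : a ∈ Finset.univ) => h1 a
    rw [Finset.sum_const, Finset.card_univ, nsmul_eq_mul] at h3
    have h4 : (Fintype.card α : ℝ) * c ≤ 1 / 4 := by
      rw [hc, mul_one_div, div_le_div_iff₀ (by positivity) (by norm_num)]
      linarith
    linarith
  have hub : ∑ x ∈ A', iid t n x ≤ A'.card * Real.exp (-(n * (H - (H - r) / 2))) := by
    rw [← nsmul_eq_mul]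
    refine Finset.sum_le_card_nsmul _ _ _ fun x hx => ?_
    rw [iid_eq_exp fun i => ht _, Real.exp_le_exp]
    have := (abs_le.1 (Finset.mem_filter.1 hx).2).1
    linarith
  have hcard : (A'.card : ℝ) ≤ A.card := by exact_mod_cast Finset.card_filter_le _ _
  refine le_trans ?_ hcard
  have h5 := hmass.trans hub
  rw [Real.exp_neg, ← div_eq_mul_inv, le_div_iff₀ (Real.exp_pos _)] at h5
  refine le_trans ?_ h5
  have h6 : Real.exp (n * (H - (H - r) / 2)) = Real.exp (n * r) * Real.exp (n * ((H - r) / 2)) := by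
    rw [← Real.exp_add]; ring_nf
  have h7 : 2 ≤ Real.exp (n * ((H - r) / 2)) := by
    exact (Real.exp_log two_pos).symm.le.trans (Real.exp_le_exp.2 hnN.le)
  rw [h6]
  nlinarith [Real.exp_pos (n * r)]

open Filter in
/-- All but `ε` of the mass of `iid p n` is carried by at most `exp (n r)` words,
for every rate `r` above the entropy of `p`. -/
theorem eventually_exists_small_support {α : Type*} [Fintype α] {p : α → ℝ}
    (hp : ∀ a, 0 ≤ p a) (hp1 : ∑ a, p a = 1) {ε r : ℝ} (hε : 0 < ε)
    (hr : ∑ a, Real.negMulLog (p a) < r) :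
    ∀ᶠ n : ℕ in atTop, ∃ B : Finset (Fin n → α), (B.card : ℝ) ≤ Real.exp (n * r) ∧
      1 - ε ≤ ∑ x ∈ B, iid p n x := by
  classical
  set H := ∑ a, Real.negMulLog (p a) with hH
  filter_upwards [eventually_deviation_le hp hp1 (fun b => -Real.log (p b)) (sub_pos.2 hr) hε]
    with n h
  rw [sum_mul_neg_log, ← hH] at h
  set G := Finset.univ.filter fun x : Fin n → α =>
    n * (r - H) < |∑ i, -Real.log (p (x i)) - n * H|
  have hG : 1 - ε ≤ ∑ x ∈ Gᶜ, iid p n x := by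
    have := Finset.sum_add_sum_compl G (iid p n)
    rw [iid_sum hp1] at this
    linarith
  refine ⟨Gᶜ.filter fun x => ∀ i, 0 < p (x i), ?_, ?_⟩
  · set B := Gᶜ.filter fun x => ∀ i, 0 < p (x i)
    have hlb : B.card * Real.exp (-(n * r)) ≤ ∑ x ∈ B, iid p n x := by
      rw [← nsmul_eq_mul]
      refine Finset.card_nsmul_le_sum _ _ _ fun x hx => ?_
      rw [Finset.mem_filter] at hx
      rw [iid_eq_exp hx.2, Real.exp_le_exp]
      have h1 := hx.1
      simp only [G, Finset.mem_compl, Finset.mem_filter, Finset.mem_univ, true_and, not_lt] at h1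
      have := (abs_le.1 h1).2
      linarith
    have h1 : ∑ x ∈ B, iid p n x ≤ 1 := by
      rw [← iid_sum hp1 n]
      exact Finset.sum_le_sum_of_subset_of_nonneg (Finset.subset_univ _)
        fun x _ _ => iid_nonneg hp n x
    have := hlb.trans h1
    rwa [Real.exp_neg, ← div_eq_mul_inv, div_le_one (Real.exp_pos _)] at this
  · rw [Finset.sum_filter_of_ne]
    · exact hG
    · intro x _ hx i
      exact (hp _).lt_of_ne' fun h0 => hx (Finset.prod_eq_zero (Finset.mem_univ i) h0)

open Filter in
/-- If the entropy of `p` is below that of `t`, a permutation of the words turns `iid p n` into a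
distribution whose average letter frequencies approximate `t`. -/
theorem eventually_exists_perm {α : Type*} [Fintype α] [DecidableEq α] {p t : α → ℝ}
    (hp : ∀ a, 0 ≤ p a) (hp1 : ∑ a, p a = 1) (ht : ∀ a, 0 < t a) (ht1 : ∑ a, t a = 1)
    (hH : ∑ a, Real.negMulLog (p a) < ∑ a, Real.negMulLog (t a)) {η : ℝ} (hη : 0 < η) :
    ∀ᶠ n : ℕ in atTop, ∃ e : Equiv.Perm (Fin n → α), ∀ a,
      |∑ x, iid p n (e x) * letterCount x a - n * t a| ≤ n * η := by
  obtain ⟨r, hr1, hr2⟩ := exists_between hH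
  filter_upwards [eventually_card_typical_ge ht ht1 (half_pos hη) hr2,
    eventually_exists_small_support hp hp1 (half_pos hη) hr1] with n hA ⟨B, hB, hBm⟩
  set A := Finset.univ.filter fun x : Fin n → α =>
        ∀ a, |letterCount x a - n * t a| ≤ n * (η / 2) with hAdef
  obtain ⟨e, he⟩ := exists_perm_mapsTo (by exact_mod_cast hB.trans hA : B.card ≤ A.card)
  refine ⟨e.symm, fun a => ?_⟩
  have hta : t a ≤ 1 := ht1 ▸ Finset.single_le_sum (fun b _ => (ht b).le) (Finset.mem_univ a)
  rw [← Equiv.sum_comp e]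
  simp only [Equiv.symm_apply_apply]
  have hrw : ∑ y, iid p n y * letterCount (e y) a - n * t a =
      ∑ y, iid p n y * (letterCount (e y) a - n * t a) := by
    simp only [mul_sub, Finset.sum_sub_distrib, ← Finset.sum_mul, iid_sum hp1, one_mul]
  rw [hrw]
  refine (Finset.abs_sum_le_sum_abs _ _).trans ?_
  have hn : (0 : ℝ) ≤ n := n.cast_nonneg
  have hpt : ∀ y, |iid p n y * (letterCount (e y) a - n * t a)| ≤
      n * (η / 2) * iid p n y + n * (if y ∈ Bᶜ then iid p n y else 0) := by
    intro y
    have h0 := iid_nonneg hp n y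
    rw [abs_mul, abs_of_nonneg h0]
    by_cases hy : y ∈ B
    · rw [if_neg (by simpa using hy)]
      have := (Finset.mem_filter.1 (he y hy)).2 a
      nlinarith
    · rw [if_pos (by simpa using hy)]
      have : |letterCount (e y) a - n * t a| ≤ n := by
        rw [abs_le]
        have h1 := letterCount_nonneg (e y) a
        have h2 := letterCount_le (e y) a
        have h3 := (ht a).le
        constructor <;> nlinarith
      have h4 : 0 ≤ n * (η / 2) * iid p n y := by positivity
      nlinarith
  refine (Finset.sum_le_sum fun y _ => hpt y).trans ?_
  rw [Finset.sum_add_distrib, ← Finset.mul_sum, ← Finset.mul_sum, iid_sum hp1,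
    ← Finset.sum_filter, Finset.filter_mem_eq_inter, Finset.univ_inter]
  have := Finset.sum_add_sum_compl B (iid p n)
  rw [iid_sum hp1] at this
  have : ∑ y ∈ Bᶜ, iid p n y ≤ η / 2 := by linarith
  nlinarith

/-- The letter frequencies of `iid p n` become exactly those of `q` after a suitable
mixture of permutations of the words. -/
theorem exists_mem_convexHull_letterCount {α : Type*} [Fintype α] [DecidableEq α] {p q : α → ℝ}
    (hp : ∀ a, 0 ≤ p a) (hp1 : ∑ a, p a = 1) (hq : ∀ a, 0 < q a) (hq1 : ∑ a, q a = 1)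
    (hH : ∑ a, Real.negMulLog (p a) < ∑ a, Real.negMulLog (q a)) :
    ∃ (N : ℕ) (Ξ : (Fin (N + 1) → α) → ℝ),
      Ξ ∈ convexHull ℝ (Set.range fun e : Equiv.Perm (Fin (N + 1) → α) => iid p (N + 1) ∘ e) ∧
      ∀ a, ∑ x, Ξ x * letterCount x a = (N + 1) * q a := by
  have hne : Nonempty α := by
    by_contra h
    rw [not_nonempty_iff] at h
    simp at hq1
  obtain ⟨a₀, ha₀⟩ := Finite.exists_min q
  set c := q a₀ with hc
  have hc0 : 0 < c := hq a₀
  have hc1 : c ≤ 1 := hq1 ▸ Finset.single_le_sum (fun b _ => (hq b).le) (Finset.mem_univ a₀)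
  let t : ℝ → α → α → ℝ := fun ε j a => (1 - ε) * q a + ε * if a = j then 1 else 0
  obtain ⟨ε, hε, hε0, hε1⟩ : ∃ ε, (∀ j, ∑ a, Real.negMulLog (p a) <
      ∑ a, Real.negMulLog (t ε j a)) ∧ 0 < ε ∧ ε < 1 := by
    have h1 : ∀ᶠ ε in nhds (0 : ℝ), ∀ j, ∑ a, Real.negMulLog (p a) <
        ∑ a, Real.negMulLog (t ε j a) := by
      rw [Filter.eventually_all]
      intro j
      have hcont : Continuous fun ε => ∑ a, Real.negMulLog (t ε j a) := by
        refine continuous_finsetSum _ fun a _ => Real.continuous_negMulLog.comp ?_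
        fun_prop
      refine (hcont.tendsto 0).eventually_const_lt ?_
      simpa [t] using hH
    have h2 := (h1.filter_mono nhdsWithin_le_nhds).and
      (Ioo_mem_nhdsGT (show (0 : ℝ) < 1 by norm_num))
    obtain ⟨ε, h, h'⟩ := h2.exists
    exact ⟨ε, h, h'.1, h'.2⟩
  have ht : ∀ j a, 0 < t ε j a := fun j a => by
    have := mul_pos (sub_pos.2 hε1) (hq a)
    simp only [t]
    split_ifs <;> linarith
  have ht1 : ∀ j, ∑ a, t ε j a = 1 := fun j => by
    simp [t, Finset.sum_add_distrib, ← Finset.mul_sum, hq1]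
  set K := (Fintype.card α : ℝ) with hK
  have hK0 : 0 < K := Nat.cast_pos.2 Fintype.card_pos
  set η := ε * c / K with hη
  have hη0 : 0 < η := by positivity
  have hev := Filter.eventually_all.2 fun j =>
    eventually_exists_perm hp hp1 (ht j) (ht1 j) (hε j) hη0
  obtain ⟨n, hn, hn1⟩ := (hev.and (Filter.eventually_ge_atTop 1)).exists
  obtain ⟨N, rfl⟩ : ∃ N, n = N + 1 := ⟨n - 1, by omega⟩
  choose e he using hn
  set n : ℝ := ((N + 1 : ℕ) : ℝ) with hndef
  have hn0 : 0 < n := by rw [hndef]; positivity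
  let m : α → α → ℝ := fun j a => ∑ x, iid p (N + 1) (e j x) * letterCount x a
  have hmsum : ∀ j, ∑ a, m j a = n := fun j => by
    simp only [m]
    rw [Finset.sum_comm]
    simp only [← Finset.mul_sum, letterCount_sum, ← Finset.sum_mul]
    rw [Equiv.sum_comp (e j) (iid p (N + 1)), iid_sum hp1, one_mul]
  have hmem : n • q ∈ convexHull ℝ (Set.range m) := by
    by_contra hcon
    obtain ⟨f, u, hf1, hf2⟩ := geometric_hahn_banach_closed_point (convex_convexHull ℝ _)
      ((Set.finite_range m).isClosed_convexHull ℝ) hcon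
    set h : α → ℝ := fun a => f (Pi.single a 1) with hh
    have hf : ∀ v : α → ℝ, f v = ∑ a, v a * h a := fun v => by
      conv_lhs => rw [← Finset.univ_sum_single v, map_sum]
      refine Finset.sum_congr rfl fun a _ => ?_
      rw [hh, ← smul_eq_mul, ← map_smul, ← Pi.single_smul, smul_eq_mul, mul_one]
    set μ := ∑ a, q a * h a with hμ
    set k : α → ℝ := fun a => h a - μ with hk
    have hqk : ∑ a, q a * k a = 0 := by
      simp only [hk, mul_sub, Finset.sum_sub_distrib, ← Finset.sum_mul, hq1, ← hμ]
      ring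
    obtain ⟨j, hj⟩ := Finite.exists_max k
    have hM : 0 ≤ k j := by
      rw [← hqk]
      calc ∑ a, q a * k a ≤ ∑ a, q a * k j :=
            Finset.sum_le_sum fun a _ => mul_le_mul_of_nonneg_left (hj a) (hq a).le
        _ = k j := by rw [← Finset.sum_mul, hq1, one_mul]
    have hbd : ∀ a, c * |k a| ≤ k j := by
      intro a
      rcases le_total 0 (k a) with h0 | h0
      · rw [abs_of_nonneg h0]
        nlinarith [hj a]
      · rw [abs_of_nonpos h0]
        have h1 : ∑ b, q b * (k j - k b) = k j := by
          simp only [mul_sub, Finset.sum_sub_distrib, hqk, ← Finset.sum_mul, hq1]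
          ring
        have h2 := Finset.single_le_sum (f := fun b => q b * (k j - k b))
          (fun b _ => mul_nonneg (hq b).le (sub_nonneg.2 (hj b))) (Finset.mem_univ a)
        rw [h1] at h2
        have h3 := mul_nonneg (hq a).le hM
        have h4 := mul_le_mul_of_nonneg_right (ha₀ a) (neg_nonneg.2 h0)
        nlinarith
    have htk : ∑ a, t ε j a * k a = ε * k j := by
      simp only [t, add_mul, mul_assoc, Finset.sum_add_distrib, ← Finset.mul_sum, hqk]
      simp
    have hmk : ∑ a, m j a * k a = f (m j) - f (n • q) := by
      simp only [hf, hk, mul_sub, Finset.sum_sub_distrib, ← Finset.sum_mul, hmsum, Pi.smul_apply,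
        smul_eq_mul, mul_assoc, ← Finset.mul_sum, hμ]
    have herr : -(n * ε * k j) ≤ ∑ a, (m j a - n * t ε j a) * k a := by
      have h1 : ∀ a ∈ (Finset.univ : Finset α),
          -(n * ε * k j / K) ≤ (m j a - n * t ε j a) * k a := by
        intro a _
        refine (abs_le.1 ?_).1
        rw [abs_mul]
        calc |m j a - n * t ε j a| * |k a| ≤ (n * η) * |k a| :=
              mul_le_mul_of_nonneg_right (he j a) (abs_nonneg _)
          _ = n * ε / K * (c * |k a|) := by rw [hη]; ring
          _ ≤ n * ε / K * k j := mul_le_mul_of_nonneg_left (hbd a) (by positivity)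
          _ = n * ε * k j / K := by ring
      have h2 := Finset.card_nsmul_le_sum _ _ _ h1
      rw [Finset.card_univ, nsmul_eq_mul, ← hK] at h2
      refine le_trans (le_of_eq ?_) h2
      field_simp
    have hfin : 0 ≤ ∑ a, m j a * k a := by
      have : ∑ a, m j a * k a = n * ∑ a, t ε j a * k a + ∑ a, (m j a - n * t ε j a) * k a := by
        rw [Finset.mul_sum, ← Finset.sum_add_distrib]
        exact Finset.sum_congr rfl fun a _ => by ring
      rw [this, htk]
      linarith
    have := hf1 (m j) (subset_convexHull ℝ _ ⟨j, rfl⟩)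
    linarith
  let avg : ((Fin (N + 1) → α) → ℝ) →ₗ[ℝ] (α → ℝ) :=
    { toFun := fun Q a => ∑ x, Q x * letterCount x a
      map_add' := fun Q R => by
        ext a
        simp [add_mul, Finset.sum_add_distrib]
      map_smul' := fun r Q => by
        ext a
        simp [mul_assoc, Finset.mul_sum] }
  have hsub : Set.range m ⊆
      avg '' Set.range fun e : Equiv.Perm (Fin (N + 1) → α) => iid p (N + 1) ∘ e := by
    rintro _ ⟨j, rfl⟩
    exact ⟨_, ⟨e j, rfl⟩, rfl⟩
  have := convexHull_mono hsub hmem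
  rw [← LinearMap.image_convexHull] at this
  obtain ⟨Ξ, hΞ, hΞq⟩ := this
  refine ⟨N, Ξ, hΞ, fun a => ?_⟩
  have := congrFun hΞq a
  simpa [avg, n] using this

/-! ### Mixtures of permutations -/

/-- The convex hull of the rearrangements of `a`. -/
def permHull {ι : Type*} (a : ι → ℝ) : Set (ι → ℝ) :=
  convexHull ℝ (Set.range fun e : Equiv.Perm ι => a ∘ e)

theorem comp_mem_permHull {ι : Type*} (a : ι → ℝ) (e : Equiv.Perm ι) : a ∘ e ∈ permHull a :=
  subset_convexHull ℝ _ ⟨e, rfl⟩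

theorem map_mem_permHull {ι κ : Type*} {a : ι → ℝ} {b : κ → ℝ} (L : (ι → ℝ) → κ → ℝ)
    (hL : ∀ x y (s t : ℝ), s + t = 1 → L (s • x + t • y) = s • L x + t • L y)
    (h : ∀ e : Equiv.Perm ι, L (a ∘ e) ∈ permHull b) {x : ι → ℝ} (hx : x ∈ permHull a) :
    L x ∈ permHull b := by
  have : Convex ℝ {x | L x ∈ permHull b} := by
    intro x hx y hy s t hs ht hst
    simp only [Set.mem_ofPred_eq, hL x y s t hst]
    exact convex_convexHull ℝ _ hx hy hs ht hst
  refine convexHull_min ?_ this hx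
  rintro _ ⟨e, rfl⟩
  exact h e

theorem comp_equiv_mem_permHull {ι κ : Type*} {a x : ι → ℝ} (hx : x ∈ permHull a) (F G : κ ≃ ι) :
    x ∘ F ∈ permHull (a ∘ G) := by
  refine map_mem_permHull (fun x => x ∘ F) (fun _ _ _ _ _ => rfl) (fun e => ?_) hx
  have : (a ∘ e) ∘ F = (a ∘ G) ∘ ((F.trans e).trans G.symm) := by
    ext k
    simp
  rw [this]
  exact comp_mem_permHull _ _

theorem extend_mem_permHull {ι κ : Type*} {a x : κ → ℝ} (hx : x ∈ permHull a) (f : κ ↪ ι) :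
    Function.extend f x 0 ∈ permHull (Function.extend f a 0) := by
  classical
  refine map_mem_permHull (fun x => Function.extend f x 0) (fun x y s t _ => ?_) (fun e => ?_) hx
  · ext i
    by_cases h : ∃ k, f k = i
    · obtain ⟨k, rfl⟩ := h
      simp [f.injective.extend_apply]
    · simp [Function.extend_apply' _ _ _ h]
  · have : Function.extend f (a ∘ e) 0 = Function.extend f a 0 ∘ e.viaEmbedding f := by
      ext i
      by_cases h : ∃ k, f k = i
      · obtain ⟨k, rfl⟩ := h
        rw [Function.comp_apply, Equiv.Perm.viaEmbedding_apply, f.injective.extend_apply,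
          f.injective.extend_apply, Function.comp_apply]
      · rw [Function.comp_apply, Equiv.Perm.viaEmbedding_apply_of_notMem _ _ _ h,
          Function.extend_apply' _ _ _ h, Function.extend_apply' _ _ _ h]
    simp only [this]
    exact comp_mem_permHull _ _

theorem nonneg_of_mem_permHull {ι : Type*} {a x : ι → ℝ} (hx : x ∈ permHull a)
    (ha : ∀ i, 0 ≤ a i) (i : ι) : 0 ≤ x i := by
  have : Convex ℝ {x : ι → ℝ | 0 ≤ x i} :=
    convex_halfSpace_ge (IsLinearMap.mk (fun _ _ => rfl) fun _ _ => rfl) 0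
  refine convexHull_min ?_ this hx
  rintro _ ⟨e, rfl⟩
  exact ha _

theorem sum_of_mem_permHull {ι : Type*} [Fintype ι] {a x : ι → ℝ} (hx : x ∈ permHull a) :
    ∑ i, x i = ∑ i, a i := by
  have : Convex ℝ {x : ι → ℝ | ∑ i, x i = ∑ i, a i} :=
    convex_hyperplane (IsLinearMap.mk (fun x y => by simp [Finset.sum_add_distrib])
      fun r x => by simp [Finset.mul_sum]) _
  refine convexHull_min ?_ this hx
  rintro _ ⟨e, rfl⟩
  exact Equiv.sum_comp e a

/-! ### The correlated catalyst -/

/-- One slot of the hybrid distribution: a copy of the letter `z` if `i < m`, and a fresh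
sample of `p` otherwise. -/
def slotKernel {α : Type*} [DecidableEq α] (p : α → ℝ) (m i : ℕ) (z x : α) : ℝ :=
  if i < m then if x = z then 1 else 0 else p x

theorem slotKernel_nonneg {α : Type*} [DecidableEq α] {p : α → ℝ} (hp : ∀ a, 0 ≤ p a)
    (m i : ℕ) (z x : α) : 0 ≤ slotKernel p m i z x := by
  unfold slotKernel
  split_ifs <;> simp [hp]

theorem sum_slotKernel {α : Type*} [Fintype α] [DecidableEq α] {p : α → ℝ} (hp1 : ∑ a, p a = 1)
    (m i : ℕ) (z : α) : ∑ x, slotKernel p m i z x = 1 := by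
  unfold slotKernel
  split_ifs <;> simp [hp1]

theorem sum_prod_slotKernel {α : Type*} [Fintype α] [DecidableEq α] {p : α → ℝ}
    (hp1 : ∑ a, p a = 1) (m : ℕ) {n : ℕ} (s : Fin n → ℕ) (z : Fin n → α) :
    ∑ x : Fin n → α, ∏ i, slotKernel p m (s i) (z i) (x i) = 1 := by
  have := Finset.prod_univ_sum (fun _ : Fin n => (Finset.univ : Finset α))
    (fun i a => slotKernel p m (s i) (z i) a)
  simp only [sum_slotKernel hp1, Finset.prod_const_one, Fintype.piFinset_univ] at this
  exact this.symm

/-- The distribution whose first `m` letters follow `Ξ` and whose other letters are independent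
samples of `p`. -/
def hybrid {α : Type*} [Fintype α] [DecidableEq α] (p : α → ℝ) {n : ℕ} (Ξ : (Fin n → α) → ℝ)
    (m : ℕ) (x : Fin n → α) : ℝ :=
  ∑ z, Ξ z * ∏ i : Fin n, slotKernel p m i (z i) (x i)

/-- The distribution `hybrid p Ξ j` with its slot `j` removed. -/
def hybridRest {α : Type*} [Fintype α] [DecidableEq α] (p : α → ℝ) {N : ℕ}
    (Ξ : (Fin (N + 1) → α) → ℝ) (j : Fin (N + 1)) (y : Fin N → α) : ℝ :=
  ∑ z, Ξ z * ∏ i : Fin N, slotKernel p j (j.succAbove i) (z (j.succAbove i)) (y i)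

theorem hybrid_zero {α : Type*} [Fintype α] [DecidableEq α] (p : α → ℝ) {n : ℕ}
    {Ξ : (Fin n → α) → ℝ} (hΞ : ∑ z, Ξ z = 1) : hybrid p Ξ 0 = iid p n := by
  ext x
  simp [hybrid, slotKernel, ← Finset.sum_mul, hΞ, iid]

theorem hybrid_self {α : Type*} [Fintype α] [DecidableEq α] (p : α → ℝ) {n : ℕ}
    (Ξ : (Fin n → α) → ℝ) : hybrid p Ξ n = Ξ := by
  ext x
  rw [hybrid, Finset.sum_eq_single x]
  · simp [slotKernel]
  · intro z _ hz
    obtain ⟨i, hi⟩ := Function.ne_iff.1 hz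
    rw [Finset.prod_eq_zero (Finset.mem_univ i), mul_zero]
    simp [slotKernel, Ne.symm hi]
  · simp

theorem hybrid_insertNth {α : Type*} [Fintype α] [DecidableEq α] (p : α → ℝ) {N : ℕ}
    (Ξ : (Fin (N + 1) → α) → ℝ) (j : Fin (N + 1)) (a : α) (y : Fin N → α) :
    hybrid p Ξ j (j.insertNth (α := fun _ => α) a y) = p a * hybridRest p Ξ j y := by
  simp only [hybrid, hybridRest, Finset.mul_sum]
  refine Finset.sum_congr rfl fun z _ => ?_
  rw [Fin.prod_univ_succAbove _ j]
  simp only [Fin.insertNth_apply_same, Fin.insertNth_apply_succAbove]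
  have : slotKernel p j j (z j) a = p a := by simp [slotKernel]
  rw [this]
  ring

theorem hybrid_succ_insertNth {α : Type*} [Fintype α] [DecidableEq α] (p : α → ℝ) {N : ℕ}
    (Ξ : (Fin (N + 1) → α) → ℝ) (j : Fin (N + 1)) (a : α) (y : Fin N → α) :
    hybrid p Ξ (j + 1) (j.insertNth (α := fun _ => α) a y) =
      ∑ z, (if z j = a then 1 else 0) * (Ξ z *
        ∏ i : Fin N, slotKernel p j (j.succAbove i) (z (j.succAbove i)) (y i)) := by
  simp only [hybrid]
  refine Finset.sum_congr rfl fun z _ => ?_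
  rw [Fin.prod_univ_succAbove _ j]
  simp only [Fin.insertNth_apply_same, Fin.insertNth_apply_succAbove]
  have h1 : slotKernel p (j + 1) j (z j) a = if z j = a then 1 else 0 := by
    simp [slotKernel, eq_comm]
  have h2 : ∀ i b c, slotKernel p (j + 1) (j.succAbove i) b c =
      slotKernel p j (j.succAbove i) b c := by
    intro i b c
    have hne : (j.succAbove i : ℕ) ≠ j := fun h => j.succAbove_ne i (Fin.ext h)
    have : (j.succAbove i : ℕ) < j + 1 ↔ (j.succAbove i : ℕ) < j := by omega
    simp only [slotKernel, this]
  rw [h1, Finset.prod_congr rfl fun i _ => h2 i _ _]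
  ring

/-- The classical core: below the entropy of a fully supported `q`, the distribution `p` can be
brought to `q` by mixing permutations jointly with a catalyst whose marginal is preserved. -/
theorem exists_catalyst_of_pos {α : Type*} [Fintype α] [DecidableEq α] {p q : α → ℝ}
    (hp : ∀ a, 0 ≤ p a) (hp1 : ∑ a, p a = 1) (hq : ∀ a, 0 < q a) (hq1 : ∑ a, q a = 1)
    (hH : ∑ a, Real.negMulLog (p a) < ∑ a, Real.negMulLog (q a)) :
    ∃ (m : ℕ) (t : Fin m → ℝ) (g : α × Fin m → ℝ), (∀ k, 0 ≤ t k) ∧ ∑ k, t k = 1 ∧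
      g ∈ permHull (fun x : α × Fin m => p x.1 * t x.2) ∧
      (∀ a, ∑ k, g (a, k) = q a) ∧ ∀ k, ∑ a, g (a, k) = t k := by
  obtain ⟨N, Ξ, hΞ, hΞq⟩ := exists_mem_convexHull_letterCount hp hp1 hq hq1 hH
  change Ξ ∈ permHull (iid p (N + 1)) at hΞ
  have hΞ0 := nonneg_of_mem_permHull hΞ (iid_nonneg hp _)
  have hΞ1 : ∑ z, Ξ z = 1 := (sum_of_mem_permHull hΞ).trans (iid_sum hp1 _)
  have hN : (0 : ℝ) < N + 1 := by positivity
  let C := Fin (N + 1) × (Fin N → α)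
  let c : C ≃ Fin (Fintype.card C) := Fintype.equivFin C
  let E : α × Fin (Fintype.card C) ≃ Fin (N + 1) × (Fin (N + 1) → α) :=
    { toFun := fun x => ((c.symm x.2).1,
        (c.symm x.2).1.insertNth (α := fun _ => α) x.1 (c.symm x.2).2)
      invFun := fun y => (y.2 y.1, c (y.1, y.1.removeNth y.2))
      left_inv := fun x => by simp
      right_inv := fun y => by simp }
  let t : Fin (Fintype.card C) → ℝ := fun k =>
    hybridRest p Ξ (c.symm k).1 (c.symm k).2 / (N + 1)
  let w : Fin (N + 1) × (Fin (N + 1) → α) → ℝ := fun y => hybrid p Ξ (y.1 + 1) y.2 / (N + 1)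
  let v : ((Fin (N + 1) → α) → ℝ) → Fin (N + 1) × (Fin (N + 1) → α) → ℝ := fun Q y =>
    if y.1 = 0 then Q y.2 / (N + 1) else hybrid p Ξ y.1 y.2 / (N + 1)
  have hwv : w = v Ξ ∘ (Equiv.prodCongr (finRotate (N + 1)) (Equiv.refl _)) := by
    ext ⟨j, x⟩
    simp only [w, v, Function.comp_apply, Equiv.prodCongr_apply, Prod.map_apply, Equiv.refl_apply]
    rcases eq_or_ne j (Fin.last N) with rfl | hj
    · have := hybrid_self p Ξ
      simp [this]
    · have h1 : ((finRotate (N + 1) j : Fin (N + 1)) : ℕ) = j + 1 := coe_finRotate_of_ne_last hj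
      have h2 : finRotate (N + 1) j ≠ 0 := fun h => by
        rw [h] at h1
        simp at h1
      rw [if_neg h2, h1]
  have hv : v Ξ ∈ permHull (v (iid p (N + 1))) := by
    refine map_mem_permHull v (fun x y r s hrs => ?_) (fun e => ?_) hΞ
    · ext y
      simp only [v, Pi.add_apply, Pi.smul_apply, smul_eq_mul]
      split_ifs
      · ring
      · rw [← add_mul, hrs, one_mul]
    · have : v (iid p (N + 1) ∘ e) = v (iid p (N + 1)) ∘
          (Equiv.prodShear (Equiv.refl (Fin (N + 1))) fun j => if j = 0 then e else Equiv.refl _) := by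
        ext ⟨j, x⟩
        by_cases hj : j = 0 <;> simp [v, hj]
      rw [this]
      exact comp_mem_permHull _ _
  have hpt : (fun x : α × Fin (Fintype.card C) => p x.1 * t x.2) = v (iid p (N + 1)) ∘ E := by
    ext ⟨a, k⟩
    have h1 : v (iid p (N + 1)) (E (a, k)) = hybrid p Ξ (E (a, k)).1 (E (a, k)).2 / (N + 1) := by
      simp only [v]
      split_ifs with h
      · rw [h, Fin.val_zero, hybrid_zero p hΞ1]
      · rfl
    rw [Function.comp_apply, h1]
    simp only [E, Equiv.coe_fn_mk, hybrid_insertNth, t, mul_div_assoc]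
  refine ⟨Fintype.card C, t, w ∘ E, fun k => ?_, ?_, ?_, fun a => ?_, fun k => ?_⟩
  · refine div_nonneg (Finset.sum_nonneg fun z _ => mul_nonneg (hΞ0 z) ?_) hN.le
    exact Finset.prod_nonneg fun i _ => slotKernel_nonneg hp _ _ _ _
  · have h1 : ∀ j : Fin (N + 1), ∑ y, hybridRest p Ξ j y = 1 := by
      intro j
      simp only [hybridRest]
      rw [Finset.sum_comm]
      simp only [← Finset.mul_sum]
      rw [← hΞ1]
      refine Finset.sum_congr rfl fun z _ => ?_
      rw [sum_prod_slotKernel hp1 j (fun i => (j.succAbove i : ℕ)) (fun i => z (j.succAbove i)),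
        mul_one]
    rw [Equiv.sum_comp c.symm (fun y : C => hybridRest p Ξ y.1 y.2 / (N + 1)),
      Fintype.sum_prod_type]
    simp only [← Finset.sum_div, h1]
    simp only [Finset.sum_const, Finset.card_univ, Fintype.card_fin, nsmul_eq_mul]
    push_cast
    rw [mul_one, div_self hN.ne']
  · rw [hpt, hwv]
    exact comp_equiv_mem_permHull hv (E.trans (Equiv.prodCongr (finRotate (N + 1)) (Equiv.refl _))) E
  · have h1 : ∀ j : Fin (N + 1), ∑ y, hybrid p Ξ (j + 1) (j.insertNth (α := fun _ => α) a y) =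
        ∑ z, Ξ z * if z j = a then 1 else 0 := by
      intro j
      simp only [hybrid_succ_insertNth]
      rw [Finset.sum_comm]
      simp only [← Finset.mul_sum]
      refine Finset.sum_congr rfl fun z _ => ?_
      rw [sum_prod_slotKernel hp1 j (fun i => (j.succAbove i : ℕ)) (fun i => z (j.succAbove i)),
        mul_one, mul_comm]
    calc ∑ k, (w ∘ E) (a, k) = ∑ y : C,
          hybrid p Ξ (y.1 + 1) (y.1.insertNth (α := fun _ => α) a y.2) / (N + 1) :=
          Equiv.sum_comp c.symm (fun y : C =>
            hybrid p Ξ (y.1 + 1) (y.1.insertNth (α := fun _ => α) a y.2) / (N + 1))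
      _ = q a := by
        rw [Fintype.sum_prod_type]
        simp only [← Finset.sum_div, h1]
        rw [Finset.sum_comm]
        simp only [← Finset.mul_sum]
        rw [div_eq_iff hN.ne', mul_comm, ← hΞq a]
        rfl
  · simp only [w, E, Function.comp_apply, Equiv.coe_fn_mk, hybrid_succ_insertNth, t, hybridRest]
    rw [← Finset.sum_div, Finset.sum_comm]
    simp only [← Finset.sum_mul]
    simp

theorem exists_catalyst {α : Type*} [Fintype α] [DecidableEq α] {p q : α → ℝ}
    (hp : ∀ a, 0 ≤ p a) (hp1 : ∑ a, p a = 1) (hq : ∀ a, 0 ≤ q a) (hq1 : ∑ a, q a = 1)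
    (hpq : ∀ a, q a = 0 → p a = 0)
    (hH : ∑ a, Real.negMulLog (p a) < ∑ a, Real.negMulLog (q a)) :
    ∃ (m : ℕ) (t : Fin m → ℝ) (g : α × Fin m → ℝ), (∀ k, 0 ≤ t k) ∧ ∑ k, t k = 1 ∧
      g ∈ permHull (fun x : α × Fin m => p x.1 * t x.2) ∧
      (∀ a, ∑ k, g (a, k) = q a) ∧ ∀ k, ∑ a, g (a, k) = t k := by
  let β := {a // q a ≠ 0}
  have hsum : ∀ f : α → ℝ, (∀ a, q a = 0 → f a = 0) → ∑ b : β, f b = ∑ a, f a := by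
    intro f hf
    rw [← Finset.sum_filter_of_ne (p := fun a => q a ≠ 0) fun a _ h h0 => h (hf a h0)]
    exact (Finset.sum_subtype _ (fun a => by simp) f).symm
  obtain ⟨m, t, g, ht, ht1, hg, hgq, hgt⟩ := exists_catalyst_of_pos (α := β)
    (p := fun b => p b) (q := fun b => q b) (fun b => hp b)
    ((hsum p hpq).trans hp1) (fun b => (hq b).lt_of_ne' b.2) ((hsum q fun _ h => h).trans hq1)
    (by
      rw [hsum (fun a => Real.negMulLog (p a)) fun a h => by simp [hpq a h],
        hsum (fun a => Real.negMulLog (q a)) fun a h => by simp [h]]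
      exact hH)
  let f : β × Fin m ↪ α × Fin m :=
    ⟨Prod.map Subtype.val id, Subtype.val_injective.prodMap Function.injective_id⟩
  have hf : ∀ (h : β × Fin m → ℝ) (b : β) k, Function.extend f h 0 ((b : α), k) = h (b, k) :=
    fun h b k => f.injective.extend_apply h 0 (b, k)
  have hf0 : ∀ (h : β × Fin m → ℝ) a k, q a = 0 → Function.extend f h 0 (a, k) = 0 := by
    intro h a k ha
    refine Function.extend_apply' _ _ _ ?_
    rintro ⟨⟨b, k'⟩, hb⟩
    exact b.2 (by rw [show (b : α) = a from congrArg Prod.fst hb, ha])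
  refine ⟨m, t, Function.extend f g 0, ht, ht1, ?_, fun a => ?_, fun k => ?_⟩
  · convert extend_mem_permHull hg f using 2
    ext ⟨a, k⟩
    by_cases ha : q a = 0
    · simp [hf0 _ a k ha, hpq a ha]
    · exact (hf (fun x : β × Fin m => p x.1 * t x.2) ⟨a, ha⟩ k).symm
  · by_cases ha : q a = 0
    · simp [hf0 _ a _ ha, ha]
    · rw [← hgq ⟨a, ha⟩]
      exact Finset.sum_congr rfl fun k _ => hf g ⟨a, ha⟩ k
  · rw [← hgt k, ← hsum _ fun a ha => hf0 g a k ha]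
    exact Finset.sum_congr rfl fun b _ => hf g b k

/-! ### Spectra and majorization -/

theorem exists_perm_of_map_eq {ι γ : Type*} [Fintype ι] {a b : ι → γ}
    (h : Finset.univ.val.map a = Finset.univ.val.map b) : ∃ e : Equiv.Perm ι, a = b ∘ e := by
  classical
  have hc : ∀ c, Fintype.card {i // a i = c} = Fintype.card {i // b i = c} := by
    intro c
    have := congrArg (Multiset.count c) h
    rw [Multiset.count_map, Multiset.count_map] at this
    simp only [eq_comm (a := c)] at this
    rw [Fintype.card_subtype, Fintype.card_subtype]
    exact this
  refine ⟨Equiv.ofFiberEquiv fun c => Fintype.equivOfCardEq (hc c), ?_⟩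
  ext i
  exact (Equiv.ofFiberEquiv_map _ i).symm

theorem le_kSum {ι : Type*} [Fintype ι] (a : ι → ℝ) (s : Finset ι) :
    ∑ i ∈ s, a i ≤ kSum a s.card := by
  have h := Finite.le_ciSup
    (fun s' : Finset ι => ⨆ _ : s' ∈ {s' : Finset ι | s'.card = s.card}, ∑ i ∈ s', a i) s
  exact le_trans (by simp) h

theorem kSum_nonneg {ι : Type*} [Fintype ι] {a : ι → ℝ} (ha : ∀ i, 0 ≤ a i) (k : ℕ) :
    0 ≤ kSum a k :=
  Real.iSup_nonneg fun _ => Real.iSup_nonneg fun _ => Finset.sum_nonneg fun i _ => ha i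

theorem maj_of_mem_permHull {ι : Type*} [Fintype ι] {a x : ι → ℝ} (ha : ∀ i, 0 ≤ a i)
    (hx : x ∈ permHull a) : Maj a x := by
  refine ⟨fun k => ?_, (sum_of_mem_permHull hx).symm⟩
  refine Real.iSup_le (fun s => Real.iSup_le (fun hs => ?_) (kSum_nonneg ha k)) (kSum_nonneg ha k)
  obtain rfl : s.card = k := hs
  have : Convex ℝ {x : ι → ℝ | ∑ i ∈ s, x i ≤ kSum a s.card} :=
    convex_halfSpace_le (IsLinearMap.mk (fun x y => by simp [Finset.sum_add_distrib])
      fun r x => by simp [Finset.mul_sum]) _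
  refine convexHull_min ?_ this hx
  rintro _ ⟨e, rfl⟩
  have h := le_kSum a (s.map e.toEmbedding)
  simpa using h

theorem eigs_conj_diagonal {ι : Type*} [Fintype ι] [DecidableEq ι] {U : Matrix ι ι ℂ}
    (hU : U ∈ unitary (Matrix ι ι ℂ)) (d : ι → ℝ) :
    ∃ e : Equiv.Perm ι, eigs (U * diagonal (fun i => (d i : ℂ)) * Uᴴ) = d ∘ e := by
  have hH : (U * diagonal (fun i => (d i : ℂ)) * Uᴴ).IsHermitian := by
    refine isHermitian_mul_mul_conjTranspose _ (isHermitian_diagonal_of_self_adjoint _ ?_)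
    ext i
    simp
  have h1 := hH.roots_charpoly_eq_eigenvalues
  have h2 : (U * diagonal (fun i => (d i : ℂ)) * Uᴴ).charpoly =
      (diagonal (fun i => (d i : ℂ))).charpoly := by
    rw [charpoly_mul_comm, ← mul_assoc, ← star_eq_conjTranspose,
      (Unitary.mem_iff.1 hU).1, one_mul]
  rw [h2, charpoly_diagonal, Polynomial.roots_prod _ _
    (by simp [Finset.prod_ne_zero_iff, Polynomial.X_sub_C_ne_zero])] at h1
  simp only [Polynomial.roots_X_sub_C, Multiset.bind_singleton] at h1
  have h3 : (Finset.univ.val.map d).map (Complex.ofReal) =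
      (Finset.univ.val.map hH.eigenvalues).map Complex.ofReal := by
    rw [Multiset.map_map, Multiset.map_map]
    exact h1
  have h4 := Multiset.map_injective Complex.ofReal_injective h3
  rw [eigs, dif_pos hH]
  exact exists_perm_of_map_eq h4.symm

theorem IsDensityMatrix.exists_eq_conj_diagonal {ι : Type*} [Fintype ι] [DecidableEq ι]
    {ρ : Matrix ι ι ℂ} (h : IsDensityMatrix ρ) :
    ∃ U ∈ unitary (Matrix ι ι ℂ), ρ = U * diagonal (fun i => (eigs ρ i : ℂ)) * Uᴴ := by
  have hH := h.1.isHermitian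
  refine ⟨hH.eigenvectorUnitary, hH.eigenvectorUnitary.2, ?_⟩
  have := hH.spectral_theorem
  rw [Unitary.conjStarAlgAut_apply] at this
  simp only [eigs, dif_pos hH]
  exact this

theorem IsDensityMatrix.eigs_nonneg {ι : Type*} [Fintype ι] [DecidableEq ι]
    {ρ : Matrix ι ι ℂ} (h : IsDensityMatrix ρ) (i : ι) : 0 ≤ eigs ρ i := by
  rw [eigs, dif_pos h.1.isHermitian]
  exact h.1.eigenvalues_nonneg i

theorem IsDensityMatrix.sum_eigs {ι : Type*} [Fintype ι] [DecidableEq ι]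
    {ρ : Matrix ι ι ℂ} (h : IsDensityMatrix ρ) : ∑ i, eigs ρ i = 1 := by
  have h1 := h.1.isHermitian.trace_eq_sum_eigenvalues
  have h1 := h.2.symm.trans h1
  rw [eigs, dif_pos h.1.isHermitian]
  apply Complex.ofReal_injective
  push_cast
  exact h1.symm

theorem IsDensityMatrix.rank_eq_card {ι : Type*} [Fintype ι] [DecidableEq ι]
    {ρ : Matrix ι ι ℂ} (h : IsDensityMatrix ρ) :
    ρ.rank = (Finset.univ.filter fun i => eigs ρ i ≠ 0).card := by
  rw [h.1.isHermitian.rank_eq_card_non_zero_eigs, Fintype.card_subtype]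
  simp only [eigs, dif_pos h.1.isHermitian]

theorem isDensityMatrix_conj_diagonal {ι : Type*} [Fintype ι] [DecidableEq ι]
    {U : Matrix ι ι ℂ} (hU : U ∈ unitary (Matrix ι ι ℂ)) {d : ι → ℝ} (hd : ∀ i, 0 ≤ d i)
    (hd1 : ∑ i, d i = 1) : IsDensityMatrix (U * diagonal (fun i => (d i : ℂ)) * Uᴴ) := by
  constructor
  · refine PosSemidef.mul_mul_conjTranspose_same (posSemidef_diagonal_iff.2 fun i => ?_) U
    exact_mod_cast hd i
  · rw [trace_mul_comm, ← mul_assoc, ← star_eq_conjTranspose, (Unitary.mem_iff.1 hU).1, one_mul,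
      trace_diagonal, ← Complex.ofReal_sum, hd1, Complex.ofReal_one]

theorem kronecker_one_conj_diagonal_apply {ι κ : Type*} [Fintype ι] [DecidableEq ι] [Fintype κ]
    [DecidableEq κ] (V : Matrix ι ι ℂ) (g : ι × κ → ℝ) (i j : ι) (k l : κ) :
    ((V ⊗ₖ (1 : Matrix κ κ ℂ)) * diagonal (fun x => (g x : ℂ)) * (V ⊗ₖ (1 : Matrix κ κ ℂ))ᴴ)
      (i, k) (j, l) = if k = l then ∑ s, V i s * g (s, k) * star (V j s) else 0 := by
  rw [Matrix.mul_apply]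
  simp only [mul_diagonal, conjTranspose_apply, kroneckerMap_apply, Fintype.sum_prod_type, one_apply]
  by_cases h : k = l
  · subst h
    simp
  · simp [h, Ne.symm h]

theorem conj_diagonal_apply {ι : Type*} [Fintype ι] [DecidableEq ι] (V : Matrix ι ι ℂ)
    (q : ι → ℂ) (i j : ι) :
    (V * diagonal q * Vᴴ) i j = ∑ s, V i s * q s * star (V j s) := by
  rw [Matrix.mul_apply]
  simp only [mul_diagonal, conjTranspose_apply]

theorem ptrace2_conj_diagonal {ι κ : Type*} [Fintype ι] [DecidableEq ι] [Fintype κ]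
    [DecidableEq κ] (V : Matrix ι ι ℂ) (g : ι × κ → ℝ) :
    ptrace2 ((V ⊗ₖ (1 : Matrix κ κ ℂ)) * diagonal (fun x => (g x : ℂ)) *
      (V ⊗ₖ (1 : Matrix κ κ ℂ))ᴴ) = V * diagonal (fun i => ((∑ k, g (i, k) : ℝ) : ℂ)) * Vᴴ := by
  ext i j
  rw [conj_diagonal_apply]
  simp only [ptrace2, of_apply, kronecker_one_conj_diagonal_apply, if_true]
  rw [Finset.sum_comm]
  refine Finset.sum_congr rfl fun s _ => ?_
  push_cast
  rw [Finset.mul_sum, Finset.sum_mul]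

theorem ptrace1_conj_diagonal {ι κ : Type*} [Fintype ι] [DecidableEq ι] [Fintype κ]
    [DecidableEq κ] {V : Matrix ι ι ℂ} (hV : V ∈ unitary (Matrix ι ι ℂ)) (g : ι × κ → ℝ) :
    ptrace1 ((V ⊗ₖ (1 : Matrix κ κ ℂ)) * diagonal (fun x => (g x : ℂ)) *
      (V ⊗ₖ (1 : Matrix κ κ ℂ))ᴴ) = diagonal (fun k => ((∑ i, g (i, k) : ℝ) : ℂ)) := by
  ext k l
  simp only [ptrace1, of_apply, kronecker_one_conj_diagonal_apply]
  by_cases h : k = l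
  · subst h
    simp only [if_true, diagonal_apply_eq]
    rw [Finset.sum_comm]
    push_cast
    refine Finset.sum_congr rfl fun s _ => ?_
    have h1 : ∑ i, star (V i s) * V i s = 1 := by
      have := congrFun (congrFun (Unitary.mem_iff.1 hV).1 s) s
      simpa [Matrix.mul_apply] using this
    calc ∑ i, V i s * g (s, k) * star (V i s) = g (s, k) * ∑ i, star (V i s) * V i s := by
          rw [Finset.mul_sum]
          exact Finset.sum_congr rfl fun i _ => by ring
      _ = g (s, k) := by rw [h1, mul_one]
  · simp [h]

theorem kronecker_diagonal_conj {ι κ : Type*} [Fintype ι] [DecidableEq ι] [Fintype κ]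
    [DecidableEq κ] (U : Matrix ι ι ℂ) (p : ι → ℝ) (t : κ → ℝ) :
    (U * diagonal (fun i => (p i : ℂ)) * Uᴴ) ⊗ₖ diagonal (fun k => (t k : ℂ)) =
      (U ⊗ₖ (1 : Matrix κ κ ℂ)) * diagonal (fun x : ι × κ => ((p x.1 * t x.2 : ℝ) : ℂ)) *
        (U ⊗ₖ (1 : Matrix κ κ ℂ))ᴴ := by
  have : diagonal (fun x : ι × κ => ((p x.1 * t x.2 : ℝ) : ℂ)) =
      diagonal (fun i => (p i : ℂ)) ⊗ₖ diagonal (fun k => (t k : ℂ)) := by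
    rw [diagonal_kronecker_diagonal]
    push_cast
    rfl
  rw [this, conjTranspose_kronecker, conjTranspose_one, ← mul_kronecker_mul, ← mul_kronecker_mul,
    one_mul, mul_one]

/-- correlating-catalytic majorization, Müller 2018. If `S(ρ) < S(ρ')`
and `rank ρ ≤ rank ρ'`, then there exist a density matrix `τ` and a bipartite density
matrix `γ` such that `ρ ⊗ τ` majorizes `γ`, `tr₂[γ] = ρ'` and `tr₁[γ] = τ`. -/
theorem stmt16 {n : ℕ} (ρ ρ' : Matrix (Fin n) (Fin n) ℂ)
    (hρ : IsDensityMatrix ρ) (hρ' : IsDensityMatrix ρ')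
    (hS : vN ρ < vN ρ') (hrank : ρ.rank ≤ ρ'.rank) :
    ∃ (m : ℕ) (τ : Matrix (Fin m) (Fin m) ℂ)
      (γ : Matrix (Fin n × Fin m) (Fin n × Fin m) ℂ),
      IsDensityMatrix τ ∧ IsDensityMatrix γ ∧
      Maj (eigs (ρ ⊗ₖ τ)) (eigs γ) ∧
      ptrace2 γ = ρ' ∧ ptrace1 γ = τ := by
  have hp := hρ.eigs_nonneg
  have hq := hρ'.eigs_nonneg
  obtain ⟨U, hU, hρU⟩ := hρ.exists_eq_conj_diagonal
  obtain ⟨V, hV, hρV⟩ := hρ'.exists_eq_conj_diagonal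
  rw [hρ.rank_eq_card, hρ'.rank_eq_card] at hrank
  obtain ⟨e, he⟩ := exists_perm_mapsTo hrank
  obtain ⟨m, t, g, ht, ht1, hg, hgq, hgt⟩ := exists_catalyst (p := eigs ρ ∘ e.symm) (q := eigs ρ')
    (fun _ => hp _) ((Equiv.sum_comp e.symm (eigs ρ)).trans hρ.sum_eigs) hq hρ'.sum_eigs
    (fun a ha => by
      by_contra h
      have := he (e.symm a) (by simpa using h)
      simp [ha] at this)
    ((Equiv.sum_comp e.symm fun i => Real.negMulLog (eigs ρ i)).trans_lt hS)
  have hone : (1 : Matrix (Fin m) (Fin m) ℂ) ∈ unitary (Matrix (Fin m) (Fin m) ℂ) := one_mem _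
  have hUm := kronecker_mem_unitary hU hone
  have hVm := kronecker_mem_unitary hV hone
  have hg0 := nonneg_of_mem_permHull hg fun x => mul_nonneg (hp _) (ht _)
  have hg1 : ∑ x, g x = 1 := by
    rw [Fintype.sum_prod_type]
    simp only [hgq, hρ'.sum_eigs]
  refine ⟨m, diagonal fun k => (t k : ℂ), (V ⊗ₖ (1 : Matrix (Fin m) (Fin m) ℂ)) *
    diagonal (fun x => (g x : ℂ)) * (V ⊗ₖ (1 : Matrix (Fin m) (Fin m) ℂ))ᴴ, ?_,
    isDensityMatrix_conj_diagonal hVm hg0 hg1, ?_, ?_, ?_⟩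
  · simpa using isDensityMatrix_conj_diagonal hone ht ht1
  · obtain ⟨e₂, he₂⟩ := eigs_conj_diagonal hVm g
    obtain ⟨e₁, he₁⟩ := eigs_conj_diagonal hUm fun x : Fin n × Fin m => eigs ρ x.1 * t x.2
    rw [← kronecker_diagonal_conj, ← hρU] at he₁
    rw [he₁, he₂]
    refine maj_of_mem_permHull (fun x => mul_nonneg (hp _) (ht _)) ?_
    convert comp_equiv_mem_permHull hg e₂
      (e₁.trans (Equiv.prodCongr e (Equiv.refl _))) using 2
    ext x
    simp
  · rw [ptrace2_conj_diagonal]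
    simp only [hgq]
    exact hρV.symm
  · rw [ptrace1_conj_diagonal hV]
    simp only [hgt]
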